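/- arXiv:1201.5838 — 2 statements merged into one kernel-verified Lean document; each statement's English description precedes it below -/
import Mathlib

section
/- Theorem 3 (weak converse for variable-length coding with feedback): for any variable-length feedback code with M ≥ 2 messages over a discrete memoryless channel of capacity C > 0, if the stopping time T satisfies E[T] < ∞ and the error probability satisfies P(Ŵ ≠ W) ≤ ε for some ε ∈ (0,1), then log M ≤ 1 + ε·log M + C·E[T]; consequently the rate satisfies log M / E[T] ≤ (C/(1−ε))·(1 + 1/(C·E[T])). -/
open MeasureTheory ProbabilityTheory Finset

/-- A form of Fano's inequality: the divergence of a nonnegative vector from the uniform vector of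
the same total mass is bounded below by the mass of any single index times `log₂` of the number of
indices, up to the total mass. -/
theorem guess_mul_logb_card_sub_le {ι : Type*} [Fintype ι] [DecidableEq ι]
    (hcard : 2 ≤ Fintype.card ι)
    (a : ι → ℝ) (ha : ∀ i, 0 ≤ a i) (i₀ : ι) :
    a i₀ * Real.logb 2 (Fintype.card ι) - ∑ i, a i ≤
      ∑ i, a i * Real.logb 2 (Fintype.card ι * a i / ∑ j, a j) := by
  set m : ℝ := (Fintype.card ι : ℝ) with hm
  have hm2 : (2 : ℝ) ≤ m := by rw [hm]; exact_mod_cast hcard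
  set r := ∑ j, a j with hr
  have hr0 : 0 ≤ r := Finset.sum_nonneg fun i _ => ha i
  have hlog2 : 0 < Real.log 2 := Real.log_pos one_lt_two
  let φ : ι → ℝ := fun i => if i = i₀ then m / 2 else 1 / 2
  have hφ : ∀ i, 0 < φ i := fun i => by
    dsimp only [φ]; split_ifs <;> positivity
  have hφsum : ∑ i, φ i ≤ m := by
    have : ∀ i, φ i = 1 / 2 + if i = i₀ then (m - 1) / 2 else 0 := fun i => by
      dsimp only [φ]; split_ifs <;> ring
    simp only [this, Finset.sum_add_distrib, Finset.sum_ite_eq', Finset.mem_univ, if_true,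
      Finset.sum_const, Finset.card_univ, nsmul_eq_mul, ← hm]
    linarith
  have key : ∀ i, a i * Real.logb 2 (φ i) + (a i - r * φ i / m) / Real.log 2 ≤
      a i * Real.logb 2 (m * a i / r) := fun i => by
    rcases (ha i).eq_or_lt with h | h
    · rw [← h]
      have : 0 ≤ r * φ i / m / Real.log 2 := by have := hφ i; positivity
      simp only [zero_mul, zero_sub, zero_add, neg_div]
      linarith
    · have hrpos : 0 < r := h.trans_le (Finset.single_le_sum (fun j _ => ha j) (Finset.mem_univ i))
      have hz : 0 < r * φ i / (m * a i) := by have := hφ i; positivity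
      have h1 := Real.log_le_sub_one_of_pos hz
      rw [Real.log_div (by have := hφ i; positivity) (by positivity),
        Real.log_mul hrpos.ne' (hφ i).ne'] at h1
      have h2 : a i * (r * φ i / (m * a i)) = r * φ i / m := by field_simp
      have h3 := mul_le_mul_of_nonneg_left h1 h.le
      rw [mul_sub _ _ (1 : ℝ), h2] at h3
      simp only [Real.logb]
      rw [Real.log_div (by positivity) hrpos.ne', ← mul_div_assoc, ← mul_div_assoc, ← add_div]
      gcongr
      linarith
  have hsum := Finset.sum_le_sum fun i (_ : i ∈ Finset.univ) => key i
  rw [Finset.sum_add_distrib, ← Finset.sum_div, Finset.sum_sub_distrib, ← Finset.sum_div,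
    ← Finset.mul_sum, ← hr] at hsum
  have hpos : 0 ≤ (r - r * (∑ i, φ i) / m) / Real.log 2 := by
    apply div_nonneg _ hlog2.le
    rw [sub_nonneg, div_le_iff₀ (by positivity)]
    gcongr
  have hφlog : ∑ i, a i * Real.logb 2 (φ i) = a i₀ * Real.logb 2 m - r := by
    have : ∀ i, a i * Real.logb 2 (φ i) =
        (if i = i₀ then a i * Real.logb 2 m else 0) - a i := fun i => by
      dsimp only [φ]
      split_ifs
      · rw [Real.logb_div (by positivity) two_ne_zero, Real.logb_self_eq_one one_lt_two]; ring
      · rw [one_div, Real.logb_inv, Real.logb_self_eq_one one_lt_two]; ring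
    simp [this, Finset.sum_sub_distrib, hr]
  linarith

/-- One channel use increases the (unnormalised) information about the index by at most the
capacity. -/
theorem sum_mul_logb_channel_le {𝒳 𝒴 ι : Type*} [Fintype 𝒳] [Fintype 𝒴] [Fintype ι]
    (P : 𝒳 → 𝒴 → ℝ) (hP_nonneg : ∀ x y, 0 ≤ P x y) (hP_sum : ∀ x, ∑ y, P x y = 1) (C : ℝ)
    (hC : ∀ q : 𝒳 → ℝ, (∀ x, 0 ≤ q x) → ∑ x, q x = 1 →
      ∑ x, ∑ y, q x * P x y * Real.logb 2 (P x y / ∑ x', q x' * P x' y) ≤ C)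
    (m : ℝ) (hm : 0 < m) (a : ι → ℝ) (ha : ∀ i, 0 ≤ a i) (x : ι → 𝒳) :
    ∑ y, ∑ i, a i * P (x i) y * Real.logb 2 (m * (a i * P (x i) y) / ∑ j, a j * P (x j) y) ≤
      ∑ i, a i * Real.logb 2 (m * a i / ∑ j, a j) + C * ∑ i, a i := by
  classical
  set r := ∑ j, a j with hr
  have hr0 : 0 ≤ r := Finset.sum_nonneg fun i _ => ha i
  rcases hr0.eq_or_lt with h | hrpos
  · have ha0 : ∀ i, a i = 0 := fun i =>
      (Finset.sum_eq_zero_iff_of_nonneg fun i _ => ha i).1 h.symm i (Finset.mem_univ i)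
    simp [ha0, ← h]
  let q : 𝒳 → ℝ := fun z => ∑ i, if x i = z then a i / r else 0
  have hq : ∀ F : 𝒳 → ℝ, ∑ z, q z * F z = ∑ i, a i / r * F (x i) := fun F => by
    simp only [q, Finset.sum_mul]
    rw [Finset.sum_comm]
    simp [ite_mul]
  have hq0 : ∀ z, 0 ≤ q z := fun z => Finset.sum_nonneg fun i _ => by
    have := ha i
    split_ifs <;> positivity
  have hq1 : ∑ z, q z = 1 := by
    have := hq 1
    simpa [← Finset.sum_div, ← hr, hrpos.ne'] using this
  have hout : ∀ y, ∑ z, q z * P z y = (∑ j, a j * P (x j) y) / r := fun y => by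
    rw [hq (fun z => P z y), Finset.sum_div]
    exact Finset.sum_congr rfl fun i _ => by ring
  have hcap := hC q hq0 hq1
  simp only [hout, mul_assoc, ← Finset.mul_sum] at hcap
  rw [hq (fun z => ∑ y, P z y * Real.logb 2 (P z y / ((∑ j, a j * P (x j) y) / r)))] at hcap
  have hterm : ∀ i y,
      a i * P (x i) y * Real.logb 2 (m * (a i * P (x i) y) / ∑ j, a j * P (x j) y) =
        P (x i) y * (a i * Real.logb 2 (m * a i / r)) +
        r * (a i / r * (P (x i) y * Real.logb 2 (P (x i) y / ((∑ j, a j * P (x j) y) / r)))) :=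
    fun i y => by
      rcases (ha i).eq_or_lt with h | hai
      · simp [← h]
      rcases (hP_nonneg (x i) y).eq_or_lt with h | hPi
      · simp [← h]
      have hs : 0 < ∑ j, a j * P (x j) y := (mul_pos hai hPi).trans_le
        (Finset.single_le_sum (f := fun j => a j * P (x j) y)
          (fun j _ => mul_nonneg (ha j) (hP_nonneg _ _)) (Finset.mem_univ i))
      have : m * (a i * P (x i) y) / ∑ j, a j * P (x j) y =
          m * a i / r * (P (x i) y / ((∑ j, a j * P (x j) y) / r)) := by field_simp
      rw [this, Real.logb_mul (by positivity) (by positivity)]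
      field_simp
  rw [Finset.sum_comm]
  simp only [hterm, Finset.sum_add_distrib, ← Finset.sum_mul, hP_sum, one_mul, ← Finset.mul_sum]
  nlinarith

/-- A set in the `σ`-algebra generated by the first `n` outputs depends only on these outputs. -/
theorem mem_iff_mem_of_measurableSet_iSup_comap {𝒴 Ω : Type*} [MeasurableSpace 𝒴]
    (Y : ℕ → Ω → 𝒴) (n : ℕ) (S : Set Ω)
    (hS : MeasurableSet[⨆ i ∈ Finset.range n, MeasurableSpace.comap (Y i) inferInstance] S)
    {ω ω' : Ω} (h : ∀ i < n, Y i ω = Y i ω') : ω ∈ S ↔ ω' ∈ S := by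
  have hle : (⨆ i ∈ Finset.range n, MeasurableSpace.comap (Y i) inferInstance) ≤
      MeasurableSpace.comap (fun ω (i : Fin n) => Y i ω) MeasurableSpace.pi := by
    refine iSup₂_le fun i hi => ?_
    rintro _ ⟨A, hA, rfl⟩
    exact ⟨_, measurable_pi_apply (⟨i, Finset.mem_range.1 hi⟩ : Fin n) hA, rfl⟩
  obtain ⟨A, -, rfl⟩ := hle S hS
  have : (fun i : Fin n => Y i ω) = fun i : Fin n => Y i ω' := funext fun i => h i i.2
  simp only [Set.mem_preimage, this]

/-- The probability of an event about a pair of finitely valued variables is the sum of the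
probabilities of the pairs of values satisfying it. -/
theorem sum_ite_measureReal_fiber {α β Ω : Type*} [Fintype α] [Fintype β] [MeasurableSpace Ω]
    (μ : Measure Ω) [IsFiniteMeasure μ] (U : Ω → α) (V : Ω → β)
    (hmeas : ∀ a b, MeasurableSet {ω | U ω = a ∧ V ω = b}) (R : α → β → Prop)
    [∀ a b, Decidable (R a b)] :
    ∑ b, ∑ a, (if R a b then μ.real {ω | U ω = a ∧ V ω = b} else 0) =
      μ.real {ω | R (U ω) (V ω)} := by
  classical
  have := sum_measureReal_preimage_singleton (μ := μ) (f := fun ω => (U ω, V ω))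
    (Finset.univ.filter fun c : α × β => R c.1 c.2)
    (by rintro ⟨a, b⟩ -; convert hmeas a b using 1; ext; simp)
  rw [Finset.sum_comm, ← Fintype.sum_prod_type', ← Finset.sum_filter]
  rw [Finset.sum_congr rfl fun c _ => ?_, this]
  · congr 1; ext; simp
  · congr 1; ext; simp [Prod.ext_iff]

/-- Weak converse for a feedback code truncated at time `n`: the probability of decoding correctly
before time `n`, times `log₂ M`, exceeds `C · E[min(T, n)]` by at most
`∑ j < n, P(T = j) + P(T ≥ n) = 1`. -/
theorem truncated_weak_converse {𝒳 𝒴 Ω : Type*} [Fintype 𝒳] [Fintype 𝒴]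
    [MeasurableSpace 𝒴] [MeasurableSingletonClass 𝒴]
    [MeasurableSpace Ω] (μ : Measure Ω) [IsProbabilityMeasure μ]
    (P : 𝒳 → 𝒴 → ℝ) (hP_nonneg : ∀ x y, 0 ≤ P x y) (hP_sum : ∀ x, ∑ y, P x y = 1)
    (C : ℝ)
    (hC : ∀ q : 𝒳 → ℝ, (∀ x, 0 ≤ q x) → ∑ x, q x = 1 →
      ∑ x, ∑ y, q x * P x y * Real.logb 2 (P x y / ∑ x', q x' * P x' y) ≤ C)
    (M : ℕ) (hM : 2 ≤ M)
    (W : Ω → Fin M) (hWmeas : Measurable W)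
    (hW_unif : ∀ w, μ.real {ω | W ω = w} = (M : ℝ)⁻¹)
    (Y : ℕ → Ω → 𝒴) (hYmeas : ∀ n, Measurable (Y n))
    (f : (n : ℕ) → Fin M → (Fin n → 𝒴) → 𝒳)
    (hchan : ∀ (n : ℕ) (w : Fin M) (ys : Fin n → 𝒴) (y : 𝒴),
      μ.real ({ω | Y n ω = y} ∩ {ω | W ω = w ∧ ∀ i : Fin n, Y i ω = ys i}) =
        P (f n w ys) y * μ.real {ω | W ω = w ∧ ∀ i : Fin n, Y i ω = ys i})
    (T : Ω → ℕ)
    (hT : ∀ n ω ω', (∀ i < n, Y i ω = Y i ω') → T ω = n → T ω' = n)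
    (g : (n : ℕ) → (Fin n → 𝒴) → Fin M) (n : ℕ) :
    ∑ j ∈ Finset.range n,
      (μ.real {ω | T ω = j ∧ W ω = g j (fun i => Y i ω)} * Real.logb 2 M -
        μ.real {ω | T ω = j}) - μ.real {ω | n ≤ T ω} ≤
      C * ∑ k ∈ Finset.range n, μ.real {ω | k < T ω} := by
  classical
  have hMpos : (0 : ℝ) < M := by positivity
  have hlogM : 0 ≤ Real.logb 2 M :=
    Real.logb_nonneg one_lt_two (by exact_mod_cast (by lia : 1 ≤ M))
  let hist : (n : ℕ) → Ω → Fin n → 𝒴 := fun n ω i => Y i ω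
  let p : (n : ℕ) → Fin M → (Fin n → 𝒴) → ℝ := fun n w ys => μ.real {ω | W ω = w ∧ hist n ω = ys}
  let d : (n : ℕ) → (Fin n → 𝒴) → ℝ := fun n ys =>
    ∑ w, p n w ys * Real.logb 2 (M * p n w ys / ∑ w', p n w' ys)
  let alive : (n m : ℕ) → (Fin n → 𝒴) → Prop := fun n m ys => ∃ ω, hist n ω = ys ∧ m ≤ T ω
  let stopped : (n : ℕ) → (Fin n → 𝒴) → Prop := fun n ys => ∃ ω, hist n ω = ys ∧ T ω = n
  have hp0 : ∀ n w ys, 0 ≤ p n w ys := fun n w ys => measureReal_nonneg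
  have hhist : ∀ {n ω ω'}, hist n ω = hist n ω' → ∀ i < n, Y i ω = Y i ω' :=
    fun h i hi => congrFun h ⟨i, hi⟩
  have hTlt : ∀ {n m ω ω'}, hist n ω = hist n ω' → m ≤ n + 1 → m ≤ T ω → m ≤ T ω' := by
    intro n m ω ω' h hm hω
    by_contra! hlt
    have := hT (T ω') ω' ω (fun i hi => (hhist h i (by lia)).symm) rfl
    lia
  have hstopped : ∀ n ω, stopped n (hist n ω) ↔ T ω = n := fun n ω =>
    ⟨fun ⟨_, h, h'⟩ => hT n _ _ (hhist h) h', fun h => ⟨ω, rfl, h⟩⟩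
  have halive : ∀ n m ω, m ≤ n + 1 → (alive n m (hist n ω) ↔ m ≤ T ω) := fun n m ω hm =>
    ⟨fun ⟨_, h, h'⟩ => hTlt h hm h', fun h => ⟨ω, rfl, h⟩⟩
  have hdzero : ∀ n ys, (∀ ω, hist n ω ≠ ys) → d n ys = 0 := fun n ys h => by
    have : ∀ w, p n w ys = 0 := fun w => by simp [p, h]
    simp [d, this]
  have hsum : ∀ n (R : Fin M → (Fin n → 𝒴) → Prop),
      ∑ ys, ∑ w, (if R w ys then p n w ys else 0) = μ.real {ω | R (W ω) (hist n ω)} := fun n R =>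
    sum_ite_measureReal_fiber μ W (hist n) (fun w ys =>
      (measurableSet_eq_fun hWmeas measurable_const).inter
        ((measurable_pi_lambda (hist n) fun i => hYmeas i) (measurableSet_singleton ys))) R
  have hsum' : ∀ n (R : (Fin n → 𝒴) → Prop),
      ∑ ys, (if R ys then ∑ w, p n w ys else 0) = μ.real {ω | R (hist n ω)} := fun n R => by
    rw [← hsum n fun _ => R]
    exact Finset.sum_congr rfl fun ys _ => by split_ifs <;> simp
  have hguess : ∀ n ys, p n (g n ys) ys * Real.logb 2 M - ∑ w, p n w ys ≤ d n ys := fun n ys => by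
    simpa using guess_mul_logb_card_sub_le (by simpa using hM) (fun w => p n w ys)
      (fun w => hp0 n w ys) (g n ys)
  have hpsucc : ∀ n w ys y, p (n + 1) w (Fin.snoc ys y) = p n w ys * P (f n w ys) y :=
      fun n w ys y => by
    have := hchan n w ys y
    rw [mul_comm] at this
    convert this using 2
    · ext ω
      simp only [hist, funext_iff, Fin.forall_fin_succ', Fin.snoc_castSucc, Fin.snoc_last,
        Fin.val_castSucc, Fin.val_last, Set.mem_ofPred_eq, Set.mem_inter_iff]
      tauto
    · simp only [p, hist, funext_iff]
  have hstep : ∀ n, ∑ ys, (if alive (n + 1) (n + 1) ys then d (n + 1) ys else 0) ≤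
      ∑ ys, (if alive n (n + 1) ys then d n ys else 0) + C * μ.real {ω | n < T ω} := fun n => by
    have hcap : ∀ ys, ∑ y, d (n + 1) (Fin.snoc ys y) ≤ d n ys + C * ∑ w, p n w ys := fun ys => by
      simp only [d, hpsucc]
      exact sum_mul_logb_channel_le P hP_nonneg hP_sum C hC M hMpos _ (fun w => hp0 n w ys) _
    have hreindex : ∀ F : (Fin (n + 1) → 𝒴) → ℝ, ∑ ys, F ys = ∑ ys, ∑ y, F (Fin.snoc ys y) :=
      fun F => by
        rw [← (Fin.snocEquiv fun _ => 𝒴).sum_comp, Fintype.sum_prod_type_right]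
        rfl
    have hev : {ω | n < T ω} = {ω | alive n (n + 1) (hist n ω)} := by
      ext ω; exact (halive n (n + 1) ω le_rfl).symm
    rw [hev, ← hsum' n, Finset.mul_sum, ← Finset.sum_add_distrib, hreindex]
    refine Finset.sum_le_sum fun ys _ => ?_
    have hinit : ∀ {ω y}, hist (n + 1) ω = Fin.snoc ys y → hist n ω = ys := fun {ω y} h => by
      ext i
      simpa [hist] using congrFun h i.castSucc
    split_ifs with h
    · refine le_trans (Finset.sum_le_sum fun y _ => le_of_eq ?_) (hcap ys)
      split_ifs with h'
      · rfl
      · refine (hdzero _ _ fun ω hω => h' ⟨ω, hω, ?_⟩).symm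
        obtain ⟨ω', h1, h2⟩ := h
        exact hTlt (h1.trans (hinit hω).symm) le_rfl h2
    · refine (Finset.sum_eq_zero fun y _ => if_neg ?_).trans_le (by simp)
      rintro ⟨ω, h1, h2⟩
      exact h ⟨ω, hinit h1, h2⟩
  have hsplit : ∀ n, ∑ ys, (if alive n n ys then d n ys else 0) =
      ∑ ys, (if stopped n ys then d n ys else 0) +
        ∑ ys, (if alive n (n + 1) ys then d n ys else 0) := fun n => by
    rw [← Finset.sum_add_distrib]
    refine Finset.sum_congr rfl fun ys _ => ?_
    by_cases h : ∃ ω, hist n ω = ys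
    · obtain ⟨ω, rfl⟩ := h
      rw [if_congr (halive n n ω (by lia)) rfl rfl, if_congr (halive n (n + 1) ω le_rfl) rfl rfl,
        if_congr (hstopped n ω) rfl rfl]
      split_ifs <;> first | lia | simp
    · simp [hdzero n ys (not_exists.1 h)]
  have hdecode : ∀ n, μ.real {ω | T ω = n ∧ W ω = g n (fun i => Y i ω)} * Real.logb 2 M -
      μ.real {ω | T ω = n} ≤ ∑ ys, (if stopped n ys then d n ys else 0) := fun n => by
    have h1 := hsum n fun w ys => stopped n ys ∧ w = g n ys
    have h2 := hsum' n (stopped n)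
    simp only [hstopped] at h1 h2
    rw [← h1, ← h2, Finset.sum_mul, ← Finset.sum_sub_distrib]
    refine Finset.sum_le_sum fun ys _ => ?_
    by_cases h : stopped n ys
    · simpa [h] using hguess n ys
    · simp [h]
  have hrest : -μ.real {ω | n ≤ T ω} ≤ ∑ ys, (if alive n n ys then d n ys else 0) := by
    have h2 := hsum' n (alive n n)
    simp only [halive n n _ (Nat.le_succ n)] at h2
    rw [← h2, ← Finset.sum_neg_distrib]
    refine Finset.sum_le_sum fun ys _ => ?_
    split_ifs
    · have := hguess n ys
      have := mul_nonneg (hp0 n (g n ys) ys) hlogM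
      linarith
    · simp
  have main : ∀ n, ∑ j ∈ Finset.range n,
      (μ.real {ω | T ω = j ∧ W ω = g j (fun i => Y i ω)} * Real.logb 2 M -
        μ.real {ω | T ω = j}) + ∑ ys, (if alive n n ys then d n ys else 0) ≤
      C * ∑ k ∈ Finset.range n, μ.real {ω | k < T ω} := fun n => by
    induction n with
    | zero =>
      have hp : ∀ w ys, p 0 w ys = (M : ℝ)⁻¹ := fun w ys => by
        simp [p, ← hW_unif w, Subsingleton.elim _ ys]
      simp [d, hp, hMpos.ne']
    | succ n ih =>
      rw [Finset.sum_range_succ, Finset.sum_range_succ, mul_add]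
      linarith [hstep n, hsplit n, hdecode n]
  linarith [main n]

/-- Theorem 3 (weak converse for variable-length coding with feedback): for any variable-length
feedback code with `M ≥ 2` messages over a DMC `P` of capacity `C > 0` (the maximum of the
mutual information over input pmfs `q`), if the stopping time `T` (a stopping time of the
filtration generated by the outputs `Y`) has `E[T] < ∞` and the error probability satisfies
`P(Ŵ ≠ W) ≤ ε` with `ε ∈ (0,1)`, then `log₂ M ≤ 1 + ε·log₂ M + C·E[T]`, and consequently
`log₂ M / E[T] ≤ (C/(1−ε))·(1 + 1/(C·E[T]))`.  Time is indexed from `0`: the `n`-th output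
`Y n` is produced, conditionally on the message and the previous outputs `Y 0, …, Y (n−1)`,
with pmf `P(·|f n W (Y 0,…,Y (n−1)))`, and `{T = n}` is measurable with respect to the
σ-algebra generated by the first `n` outputs. -/
theorem weak_converse_variable_length_feedback
    {𝒳 𝒴 Ω : Type*} [Fintype 𝒳] [Nonempty 𝒳] [Fintype 𝒴] [Nonempty 𝒴]
    [MeasurableSpace 𝒴] [MeasurableSingletonClass 𝒴]
    [MeasurableSpace Ω] (μ : Measure Ω) [IsProbabilityMeasure μ]
    (P : 𝒳 → 𝒴 → ℝ) (hP_nonneg : ∀ x y, 0 ≤ P x y) (hP_sum : ∀ x, ∑ y, P x y = 1)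
    (C : ℝ)
    (hC : IsGreatest {c : ℝ | ∃ q : 𝒳 → ℝ, (∀ x, 0 ≤ q x) ∧ (∑ x, q x = 1) ∧
        c = ∑ x, ∑ y, q x * P x y * Real.logb 2 (P x y / ∑ x', q x' * P x' y)} C)
    (hC_pos : 0 < C)
    (M : ℕ) (hM : 2 ≤ M)
    (W : Ω → Fin M) (hWmeas : Measurable W)
    (hW_unif : ∀ w, μ {ω | W ω = w} = (M : ENNReal)⁻¹)
    (Y : ℕ → Ω → 𝒴) (hYmeas : ∀ n, Measurable (Y n))
    (f : (n : ℕ) → Fin M → (Fin n → 𝒴) → 𝒳)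
    (hchan : ∀ (n : ℕ) (w : Fin M) (ys : Fin n → 𝒴) (y : 𝒴),
      μ ({ω | Y n ω = y} ∩ {ω | W ω = w ∧ ∀ i : Fin n, Y i ω = ys i}) =
        ENNReal.ofReal (P (f n w ys) y) * μ {ω | W ω = w ∧ ∀ i : Fin n, Y i ω = ys i})
    (T : Ω → ℕ)
    (hTstop : ∀ n : ℕ,
      MeasurableSet[⨆ i ∈ Finset.range n, MeasurableSpace.comap (Y i) inferInstance]
        {ω | T ω = n})
    (hTint : Integrable (fun ω => (T ω : ℝ)) μ)
    (g : (n : ℕ) → (Fin n → 𝒴) → Fin M)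
    (What : Ω → Fin M)
    (hWhat : ∀ ω, What ω = g (T ω) (fun i : Fin (T ω) => Y i ω))
    (ε : ℝ) (hε : ε ∈ Set.Ioo (0 : ℝ) 1)
    (herr : μ {ω | What ω ≠ W ω} ≤ ENNReal.ofReal ε) :
    Real.logb 2 M ≤ 1 + ε * Real.logb 2 M + C * ∫ ω, (T ω : ℝ) ∂μ ∧
    Real.logb 2 M / ∫ ω, (T ω : ℝ) ∂μ ≤
      (C / (1 - ε)) * (1 + 1 / (C * ∫ ω, (T ω : ℝ) ∂μ)) := by
  have hWu : ∀ w, μ.real {ω | W ω = w} = (M : ℝ)⁻¹ := fun w => by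
    simp [measureReal_def, hW_unif w]
  have hTdep : ∀ n ω ω', (∀ i < n, Y i ω = Y i ω') → T ω = n → T ω' = n := fun n ω ω' h hω =>
    (mem_iff_mem_of_measurableSet_iSup_comap Y n _ (hTstop n) h).1 hω
  have hTmeas : Measurable T := measurable_to_countable' fun n =>
    (iSup₂_le fun i _ => (hYmeas i).comap_le :
      (⨆ i ∈ Finset.range n, MeasurableSpace.comap (Y i) inferInstance) ≤ _) _ (hTstop n)
  have hbound := truncated_weak_converse μ P hP_nonneg hP_sum C
    (fun q h0 h1 => hC.2 ⟨q, h0, h1, rfl⟩) M hM W hWmeas hWu Y hYmeas f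
    (fun n w ys y => by
      simp [measureReal_def, hchan, ENNReal.toReal_mul, ENNReal.toReal_ofReal (hP_nonneg _ _)])
    T hTdep g
  set E := ∫ ω, (T ω : ℝ) ∂μ
  have hE0 : 0 ≤ E := integral_nonneg fun ω => by positivity
  have hlogM : 0 ≤ Real.logb 2 M :=
    Real.logb_nonneg one_lt_two (by exact_mod_cast (by lia : 1 ≤ M))
  have hcorrect : ∀ j, {ω | T ω = j ∧ W ω = g j (fun i => Y i ω)} =
      {ω | T ω = j} ∩ {ω | What ω = W ω} := fun j => by
    ext ω
    simp only [Set.mem_ofPred_eq, Set.mem_inter_iff, hWhat ω]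
    refine and_congr_right ?_
    rintro rfl
    exact eq_comm
  have hTlt : ∀ n, MeasurableSet {ω | T ω < n} := fun n => measurableSet_lt hTmeas measurable_const
  have hpart : ∀ n (S : Set Ω), ∑ j ∈ Finset.range n, μ.real ({ω | T ω = j} ∩ S) =
      μ.real ({ω | T ω < n} ∩ S) := fun n S => by
    have h := sum_measureReal_preimage_singleton (μ := μ.restrict S) (f := T) (Finset.range n)
      (fun j _ => hTmeas (measurableSet_singleton j))
    simp only [measureReal_restrict_apply (hTmeas (MeasurableSet.of_discrete))] at h
    convert h using 4 <;> (ext; simp)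
  have htail : ∀ n, ∑ k ∈ Finset.range n, μ.real {ω | k < T ω} ≤ E := fun n => by
    have hm : ∀ k, MeasurableSet {ω | k < T ω} := fun k => measurableSet_lt measurable_const hTmeas
    have hint : ∀ k ∈ Finset.range n, Integrable (Set.indicator {ω | k < T ω} (1 : Ω → ℝ)) μ :=
      fun k _ => (integrable_const (1 : ℝ)).indicator (hm k)
    have : ∑ k ∈ Finset.range n, μ.real {ω | k < T ω} =
        ∫ ω, ∑ k ∈ Finset.range n, Set.indicator {ω | k < T ω} (1 : Ω → ℝ) ω ∂μ := by
      rw [integral_finsetSum _ hint]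
      exact Finset.sum_congr rfl fun k _ => (integral_indicator_one (hm k)).symm
    rw [this]
    refine integral_mono (integrable_finsetSum _ hint) hTint fun ω => ?_
    simp only [Set.indicator_apply, Set.mem_ofPred_eq, Pi.one_apply, Finset.sum_boole]
    have : (Finset.range n).filter (fun k => k < T ω) ⊆ Finset.range (T ω) := fun k hk => by
      simpa using (Finset.mem_filter.1 hk).2
    exact_mod_cast (Finset.card_le_card this).trans_eq (Finset.card_range _)
  have hfin : ∀ n, μ.real ({ω | T ω < n} ∩ {ω | What ω = W ω}) * Real.logb 2 M ≤ 1 + C * E :=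
      fun n => by
    have h1 := hbound n
    simp only [hcorrect] at h1
    have h2 := hpart n Set.univ
    simp only [Set.inter_univ] at h2
    rw [Finset.sum_sub_distrib, ← Finset.sum_mul, hpart, h2] at h1
    have h3 := probReal_add_probReal_compl (μ := μ) (hTlt n)
    have h4 : {ω | T ω < n}ᶜ = {ω | n ≤ T ω} := by ext; simp
    rw [h4] at h3
    have h5 := mul_le_mul_of_nonneg_left (htail n) hC_pos.le
    linarith
  have hlim : Filter.Tendsto (fun n : ℕ => μ.real ({ω | T ω < n} ∩ {ω | What ω = W ω}))
      Filter.atTop (nhds (μ.real {ω | What ω = W ω})) := by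
    have hmono : Monotone fun n : ℕ => {ω | T ω < n} ∩ {ω | What ω = W ω} :=
      fun a b hab ω h => ⟨lt_of_lt_of_le h.1 hab, h.2⟩
    have h := tendsto_measure_iUnion_atTop (μ := μ) hmono
    have hU : ⋃ n : ℕ, {ω | T ω < n} ∩ {ω | What ω = W ω} = {ω | What ω = W ω} := by
      rw [← Set.iUnion_inter, Set.inter_eq_right]
      exact fun ω _ => Set.mem_iUnion.2 ⟨T ω + 1, Nat.lt_succ_self _⟩
    rw [hU] at h
    exact (ENNReal.tendsto_toReal (measure_ne_top _ _)).comp h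
  have hmain := le_of_tendsto' (hlim.mul_const (Real.logb 2 M)) hfin
  have herr' : 1 - ε ≤ μ.real {ω | What ω = W ω} := by
    have h1 : μ.real {ω | What ω ≠ W ω} ≤ ε :=
      ENNReal.toReal_le_of_le_ofReal hε.1.le herr
    have h2 := measureReal_union_le (μ := μ) {ω | What ω = W ω} {ω | What ω ≠ W ω}
    have h3 : {ω | What ω = W ω} ∪ {ω | What ω ≠ W ω} = Set.univ := by
      ext; simp [em]
    rw [h3, probReal_univ] at h2
    linarith
  have hfirst : (1 - ε) * Real.logb 2 M ≤ 1 + C * E :=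
    (mul_le_mul_of_nonneg_right herr' hlogM).trans hmain
  have hε1 : 0 < 1 - ε := sub_pos.2 hε.2
  refine ⟨by linarith, ?_⟩
  rcases hE0.eq_or_lt with h | h
  · rw [← h]
    simp only [div_zero, mul_zero, add_zero, mul_one]
    positivity
  · have : C / (1 - ε) * (1 + 1 / (C * E)) = (1 + C * E) / (1 - ε) / E := by
      field_simp
      ring
    rw [this]
    gcongr
    rw [le_div_iff₀ hε1]
    linarith
end

section
/- Lemma (pointwise redundancy of the Jeffreys-mixture universal probability assignment): for every t ≥ 1 and all sequences x^t ∈ 𝒳^t, y^t ∈ 𝒴^t, letting θ̂ be a maximizer of θ ↦ p_θ(x^t|y^t) over Λ, one has log(p_θ̂(x^t|y^t) / p_U(x^t|y^t)) ≤ ((|𝒳|−1)·|𝒴|/2)·log(t/(2π)) + |𝒴|·log(Γ(1/2)^{|𝒳|}/Γ(|𝒳|/2)) + (|𝒳|²·|𝒴|/4 + |𝒳|·|𝒴|/2)·log e. -/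
open MeasureTheory Finset Real

/-! We take `𝒳 = Fin (m+1)` and `𝒴 = Fin (n+1)`.  A column-stochastic matrix
`θ = (θ_{ij})_{i ∈ 𝒳, j ∈ 𝒴}` is parametrized, column by column, by its first `m` entries:
integration over `Λ` (with respect to the product over `j ∈ 𝒴` of Lebesgue measure on the
`(|𝒳|−1)`-dimensional probability simplex) is realized as integration over the parameter
domain `paramSet m n ⊆ (Fin (n+1) → Fin m → ℝ)` with respect to Lebesgue measure. -/

/-- The column-stochastic matrix determined by the parameters `U`: entry `(i,j)` is `U j i`
for `i < m`, and the last row is `1 - ∑ i', U j i'`. -/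
noncomputable def thetaOf (m n : ℕ) (U : Fin (n + 1) → Fin m → ℝ) :
    Fin (m + 1) → Fin (n + 1) → ℝ :=
  fun i j => if h : (i : ℕ) < m then U j ⟨i, h⟩ else 1 - ∑ i', U j i'

/-- Parameter domain: each column's parameters are nonnegative with sum at most `1`. -/
def paramSet (m n : ℕ) : Set (Fin (n + 1) → Fin m → ℝ) :=
  {U | ∀ j, (∀ i, 0 ≤ U j i) ∧ ∑ i, U j i ≤ 1}

/-- The normalization constant `B = ∫_Λ ∏_{i,j} θ_{ij}^{-1/2} dθ` of Jeffreys prior. -/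
noncomputable def jeffreysB (m n : ℕ) : ℝ :=
  ∫ U in paramSet m n, ∏ i, ∏ j, (thetaOf m n U i j) ^ (-(1 : ℝ) / 2)

/-- `p_θ(x^t|y^t) = ∏_{k=1}^t θ_{x_k y_k}`. -/
noncomputable def pTheta {m n : ℕ} (θ : Fin (m + 1) → Fin (n + 1) → ℝ)
    {t : ℕ} (x : Fin t → Fin (m + 1)) (y : Fin t → Fin (n + 1)) : ℝ :=
  ∏ k, θ (x k) (y k)

/-- The Jeffreys-mixture universal probability assignment
`p_U(x^t|y^t) = ∫_Λ w(θ)·p_θ(x^t|y^t) dθ` with `w(θ) = (1/B)·∏_{i,j} θ_{ij}^{-1/2}`. -/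
noncomputable def pUniv (m n : ℕ) {t : ℕ}
    (x : Fin t → Fin (m + 1)) (y : Fin t → Fin (n + 1)) : ℝ :=
  (jeffreysB m n)⁻¹ *
    ∫ U in paramSet m n,
      (∏ i, ∏ j, (thetaOf m n U i j) ^ (-(1 : ℝ) / 2)) * pTheta (thetaOf m n U) x y

/-- `Λ`: the set of column-stochastic matrices. -/
def colStoch (m n : ℕ) : Set (Fin (m + 1) → Fin (n + 1) → ℝ) :=
  {θ | (∀ i j, 0 ≤ θ i j) ∧ ∀ j, ∑ i, θ i j = 1}

theorem factorial_sq_le_of_stirling (n : ℕ) :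
    2 * π * n * (n ^ n * exp (-n)) ^ 2 ≤ (n.factorial : ℝ) ^ 2 := by
  have h := Stirling.le_factorial_stirling n
  have h2 := pow_le_pow_left₀ (by positivity) h 2
  rw [mul_pow, Real.sq_sqrt (by positivity), div_pow, ← Real.exp_nat_mul, mul_one] at h2
  rwa [Real.exp_neg, ← div_eq_mul_inv]

theorem factorial_le_exp_one_mul (n : ℕ) (hn : 1 ≤ n) :
    (n.factorial : ℝ) ≤ exp 1 * √n * (n ^ n * exp (-n)) := by
  obtain ⟨k, rfl⟩ : ∃ k, n = k + 1 := ⟨n - 1, by omega⟩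
  have h := Stirling.stirlingSeq'_antitone (Nat.zero_le k)
  simp only [Function.comp, Nat.succ_eq_add_one, zero_add, Stirling.stirlingSeq_one] at h
  rw [Stirling.stirlingSeq, div_le_div_iff₀ (by positivity) (by positivity)] at h
  rw [Real.sqrt_mul (by norm_num), div_pow, ← Real.exp_nat_mul, mul_one] at h
  have h2 : (0:ℝ) < √2 := by positivity
  rw [Real.exp_neg, ← div_eq_mul_inv]
  nlinarith

theorem sq_Gamma_midpoint_le {a b : ℝ} (ha : 0 < a) (hb : 0 < b) :
    Gamma ((a + b) / 2) ^ 2 ≤ Gamma a * Gamma b := by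
  have h := Real.Gamma_mul_add_mul_le_rpow_Gamma_mul_rpow_Gamma ha hb
    (a := 1 / 2) (b := 1 / 2) (by norm_num) (by norm_num) (by norm_num)
  rw [← Real.sqrt_eq_rpow, ← Real.sqrt_eq_rpow, ← Real.sqrt_mul (Gamma_pos_of_pos ha).le,
    show 1 / 2 * a + 1 / 2 * b = (a + b) / 2 by ring] at h
  have := Gamma_pos_of_pos ha
  have := Gamma_pos_of_pos hb
  calc _ ≤ √(Gamma a * Gamma b) ^ 2 :=
        pow_le_pow_left₀ (Gamma_pos_of_pos (by positivity)).le h 2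
    _ = _ := Real.sq_sqrt (by positivity)

theorem le_Gamma_nat_add_half (n : ℕ) :
    √(2 * π) * (n ^ n * exp (-n)) * exp (-1 / 2) ≤ Gamma (n + 1 / 2) := by
  have hG : 0 < Gamma ((n : ℝ) + 1 / 2) := Gamma_pos_of_pos (by positivity)
  refine le_of_sq_le_sq ?_ hG.le
  have he : exp (-1 / 2 : ℝ) ^ 2 = exp (-1) := by
    rw [← Real.exp_nat_mul]; norm_num
  have he2 : exp (-1) ≤ 1 / 2 := by
    rw [Real.exp_neg, inv_le_comm₀ (exp_pos _) (by norm_num)]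
    linarith [Real.add_one_le_exp 1]
  rw [mul_pow, mul_pow, Real.sq_sqrt (by positivity), he]
  rcases Nat.eq_zero_or_pos n with rfl | hn
  · norm_num [Real.Gamma_one_half_eq, Real.sq_sqrt pi_pos.le]
    nlinarith [pi_pos]
  · have hn' : (1 : ℝ) ≤ n := by exact_mod_cast hn
    have h1 := sq_Gamma_midpoint_le (a := n + 1 / 2) (b := n + 1 / 2 + 1)
      (by positivity) (by positivity)
    rw [show ((n : ℝ) + 1 / 2 + (n + 1 / 2 + 1)) / 2 = n + 1 by ring, Real.Gamma_nat_eq_factorial,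
      Real.Gamma_add_one (by positivity)] at h1
    have h2 := factorial_sq_le_of_stirling n
    set P := (n ^ n * exp (-(n : ℝ))) ^ 2
    have hP : 0 < P := by positivity
    set G := Gamma ((n : ℝ) + 1 / 2)
    have h3 : 2 * π * n * P ≤ (n + 1 / 2) * G ^ 2 := by nlinarith
    have h4 : 2 * π * P * exp (-1) ≤ π * P := by
      have : 0 < π * P := by positivity
      nlinarith
    have h5 : (n + 1 / 2) * (π * P) ≤ 2 * π * n * P := by
      have : 0 < π * P := by positivity
      nlinarith
    refine h4.trans ?_
    have : (0 : ℝ) < n + 1 / 2 := by positivity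
    exact le_of_mul_le_mul_left (h5.trans h3) this

theorem exp_one_le_sqrt_two_pi_mul : exp 1 ≤ √(2 * π) * exp (1 / 4) := by
  have h1 : (2.5 : ℝ) ≤ √(2 * π) := Real.le_sqrt_of_sq_le (by nlinarith [Real.pi_gt_d2])
  have h2 := Real.add_one_le_exp (1 / 4 : ℝ)
  have h3 : (2.5 : ℝ) * (1 / 4 + 1) ≤ √(2 * π) * exp (1 / 4) := by gcongr
  linarith [exp_one_lt_three]

theorem Gamma_nat_add_half_le (n : ℕ) :
    Gamma (n + 1 / 2) ≤ √(2 * π) * (n ^ n * exp (-n)) * exp (1 / 4) := by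
  rcases Nat.eq_zero_or_pos n with rfl | hn
  · have h : √π ≤ √(2 * π) := Real.sqrt_le_sqrt (by linarith [pi_pos])
    have : (1 : ℝ) ≤ exp (1 / 4) := Real.one_le_exp (by norm_num)
    simp only [Nat.cast_zero, zero_add, Real.Gamma_one_half_eq, pow_zero, neg_zero, exp_zero,
      mul_one]
    nlinarith [Real.sqrt_nonneg π]
  · have hn' : (0 : ℝ) < n := by exact_mod_cast hn
    have h1 := sq_Gamma_midpoint_le (a := n) (b := n + 1) (by positivity) (by positivity)
    rw [show ((n : ℝ) + (n + 1)) / 2 = n + 1 / 2 by ring] at h1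
    have h0 := Real.Gamma_add_one hn'.ne'
    rw [Real.Gamma_nat_eq_factorial] at h0 h1
    have h2 := factorial_le_exp_one_mul n hn
    set P := n ^ n * exp (-(n : ℝ))
    have hP : 0 < P := by positivity
    have h3 : Gamma ((n : ℝ) + 1 / 2) ≤ exp 1 * P := by
      refine le_of_sq_le_sq ?_ (by positivity)
      have h4 : n * Gamma (n + 1 / 2) ^ 2 ≤ n * (exp 1 * P) ^ 2 := by
        calc n * Gamma (n + 1 / 2) ^ 2 ≤ (n.factorial : ℝ) ^ 2 := by
              rw [sq (n.factorial : ℝ)]; nth_rw 1 [h0]; nlinarith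
          _ ≤ (exp 1 * √n * P) ^ 2 := by gcongr
          _ = n * (exp 1 * P) ^ 2 := by
              rw [mul_pow, mul_pow, Real.sq_sqrt hn'.le]; ring
      exact le_of_mul_le_mul_left h4 hn'
    refine h3.trans ?_
    have := exp_one_le_sqrt_two_pi_mul
    nlinarith

theorem Gamma_nat_add_one_le (n : ℕ) (s : ℝ) (hs : 1 ≤ s) (hns : n ≤ s) :
    Gamma (n + 1) ≤ √(2 * π) * (n ^ n * exp (-n)) * √s * exp 1 := by
  have h0 : (1 : ℝ) ≤ √(2 * π) := Real.one_le_sqrt.2 (by linarith [Real.pi_gt_three])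
  have h1 : 1 ≤ √s := Real.one_le_sqrt.2 hs
  have h2 : 1 ≤ exp 1 := Real.one_le_exp (by norm_num)
  rw [Real.Gamma_nat_eq_factorial]
  rcases Nat.eq_zero_or_pos n with rfl | hn
  · simp only [Nat.factorial_zero, Nat.cast_one, pow_zero, Nat.cast_zero, neg_zero, exp_zero,
      mul_one]
    exact one_le_mul_of_one_le_of_one_le (one_le_mul_of_one_le_of_one_le h0 h1) h2
  · calc (n.factorial : ℝ) ≤ exp 1 * √n * (n ^ n * exp (-n)) := factorial_le_exp_one_mul n hn
      _ ≤ exp 1 * √s * (n ^ n * exp (-n)) := by gcongr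
      _ ≤ √(2 * π) * (exp 1 * √s * (n ^ n * exp (-n))) := le_mul_of_one_le_left (by positivity) h0
      _ = _ := by ring

theorem Gamma_nat_add_half_nat_le (n : ℕ) (s : ℝ) (hs : 1 ≤ s) (hns : n ≤ s) (m : ℕ) :
    Gamma (n + ((m : ℝ) + 1) / 2) ≤
      √(2 * π) * (n ^ n * exp (-n)) * √s ^ m * exp (((m : ℝ) + 1) ^ 2 / 4) := by
  induction m using Nat.twoStepInduction with
  | zero => simpa using Gamma_nat_add_half_le n
  | one =>
    have := Gamma_nat_add_one_le n s hs hns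
    norm_num at this ⊢
    exact this
  | more m ih _ =>
    have hle : (n : ℝ) + ((m : ℝ) + 1) / 2 ≤ s * exp ((m : ℝ) + 2) := by
      have := Real.add_one_le_exp ((m : ℝ) + 2)
      have hm : (0 : ℝ) ≤ m := by positivity
      nlinarith
    push_cast
    rw [show (n : ℝ) + (m + 2 + 1) / 2 = n + ((m : ℝ) + 1) / 2 + 1 by ring,
      Real.Gamma_add_one (by positivity),
      show ((m : ℝ) + 2 + 1) ^ 2 / 4 = (m + 1) ^ 2 / 4 + (m + 2) by ring, exp_add, pow_add,
      Real.sq_sqrt (by linarith)]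
    calc _ ≤ (s * exp ((m : ℝ) + 2)) *
          (√(2 * π) * (n ^ n * exp (-n)) * √s ^ m * exp (((m : ℝ) + 1) ^ 2 / 4)) := by
            have := (Gamma_pos_of_pos (s := n + ((m : ℝ) + 1) / 2) (by positivity)).le
            gcongr
      _ = _ := by ring

theorem prod_pow_le_of_sum_eq_one {ι : Type*} [Fintype ι] (c : ι → ℕ) (q : ι → ℝ)
    (hq : ∀ i, 0 ≤ q i) (hsum : ∑ i, q i = 1) :
    (∏ i, q i ^ c i) * ((∑ i, c i : ℕ) : ℝ) ^ (∑ i, c i) ≤ ∏ i, (c i : ℝ) ^ c i := by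
  set T := ∑ i, c i with hT
  have key : ∀ i, (q i * T) ^ c i ≤ (c i : ℝ) ^ c i * exp (q i * T - c i) := by
    intro i
    rcases Nat.eq_zero_or_pos (c i) with h | h
    · rw [h]
      simpa using Real.one_le_exp (mul_nonneg (hq i) (Nat.cast_nonneg T))
    · have hc : (0 : ℝ) < c i := by exact_mod_cast h
      have h1 : q i * T ≤ c i * exp (q i * T / c i - 1) := by
        have := Real.add_one_le_exp (q i * T / c i - 1)
        rw [sub_add_cancel, div_le_iff₀ hc] at this
        linarith
      calc (q i * T) ^ c i ≤ (c i * exp (q i * T / c i - 1)) ^ c i :=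
            pow_le_pow_left₀ (mul_nonneg (hq i) (Nat.cast_nonneg T)) h1 _
        _ = _ := by
          rw [mul_pow, ← Real.exp_nat_mul]
          congr 2
          field_simp
  calc (∏ i, q i ^ c i) * (T : ℝ) ^ T = ∏ i, (q i * T) ^ c i := by
        simp_rw [mul_pow]
        rw [prod_mul_distrib, prod_pow_eq_pow_sum]
    _ ≤ ∏ i, ((c i : ℝ) ^ c i * exp (q i * T - c i)) :=
        prod_le_prod (fun i _ => pow_nonneg (mul_nonneg (hq i) (Nat.cast_nonneg T)) _)
          (fun i _ => key i)
    _ = _ := by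
        rw [prod_mul_distrib, ← Real.exp_sum, sum_sub_distrib, ← sum_mul, hsum, hT]
        push_cast
        simp

/-- The redundancy of a single column with counts `c`. -/
theorem prod_pow_mul_Gamma_le (m : ℕ) (c : Fin (m + 1) → ℕ) (q : Fin (m + 1) → ℝ)
    (hq : ∀ i, 0 ≤ q i) (hsum : ∑ i, q i = 1) (s : ℝ) (hs : 1 ≤ s)
    (hcs : ((∑ i, c i : ℕ) : ℝ) ≤ s) :
    (∏ i, q i ^ c i) * Gamma ((∑ i, c i : ℕ) + ((m : ℝ) + 1) / 2) ≤
      (√(s / (2 * π)) ^ m * exp (((m : ℝ) + 1) ^ 2 / 4 + ((m : ℝ) + 1) / 2)) *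
        ∏ i, Gamma (c i + 1 / 2) := by
  have h1 := prod_pow_le_of_sum_eq_one c q hq hsum
  have h2 := Gamma_nat_add_half_nat_le (∑ i, c i) s hs hcs m
  have h3 : √(2 * π) ^ (m + 1) * ((∏ i, (c i : ℝ) ^ c i) * exp (-((∑ i, c i : ℕ) : ℝ))) *
      exp (-(((m : ℝ) + 1) / 2)) ≤ ∏ i, Gamma (c i + 1 / 2) := by
    have := prod_le_prod (s := univ) (fun i _ => by positivity)
      (fun i _ => le_Gamma_nat_add_half (c i))
    refine le_of_eq_of_le ?_ this
    rw [prod_mul_distrib, prod_mul_distrib, prod_mul_distrib, ← Real.exp_sum]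
    simp only [prod_const, card_univ, Fintype.card_fin, sum_neg_distrib, Nat.cast_sum]
    rw [← Real.exp_nat_mul]
    push_cast
    congr 2
    ring
  set T := ∑ i, c i
  set D := ∏ i, (c i : ℝ) ^ c i
  have hQ : 0 ≤ ∏ i, q i ^ c i := prod_nonneg fun i _ => pow_nonneg (hq i) _
  calc (∏ i, q i ^ c i) * Gamma ((T : ℝ) + ((m : ℝ) + 1) / 2)
      ≤ (∏ i, q i ^ c i) *
        (√(2 * π) * (T ^ T * exp (-T)) * √s ^ m * exp (((m : ℝ) + 1) ^ 2 / 4)) := by gcongr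
    _ = ((∏ i, q i ^ c i) * (T : ℝ) ^ T) *
        (√(2 * π) * exp (-T) * √s ^ m * exp (((m : ℝ) + 1) ^ 2 / 4)) := by ring
    _ ≤ D * (√(2 * π) * exp (-T) * √s ^ m * exp (((m : ℝ) + 1) ^ 2 / 4)) := by gcongr
    _ = (√(s / (2 * π)) ^ m * exp (((m : ℝ) + 1) ^ 2 / 4 + ((m : ℝ) + 1) / 2)) *
        (√(2 * π) ^ (m + 1) * (D * exp (-(T : ℝ))) * exp (-(((m : ℝ) + 1) / 2))) := by
      rw [Real.sqrt_div (by linarith), div_pow, exp_add, Real.exp_neg (((m : ℝ) + 1) / 2)]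
      have : √(2 * π) ≠ 0 := by positivity
      field_simp
      ring
    _ ≤ _ := by gcongr

/-- The one-sided power `x ^ (a - 1)` on the positive half-line, extended by zero. -/
noncomputable def posPow (a x : ℝ) : ℝ := if 0 < x then x ^ (a - 1) else 0

theorem posPow_nonneg (a x : ℝ) : 0 ≤ posPow a x := by
  unfold posPow; split_ifs with h <;> positivity

@[fun_prop]
theorem measurable_posPow (a : ℝ) : Measurable (posPow a) :=
  Measurable.ite measurableSet_Ioi (by fun_prop) (by fun_prop)

theorem posPow_of_nonneg {a x : ℝ} (ha : a ≠ 1) (hx : 0 ≤ x) : posPow a x = x ^ (a - 1) := by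
  rcases hx.eq_or_lt with rfl | hx
  · simp [posPow, Real.zero_rpow (sub_ne_zero.2 ha)]
  · simp [posPow, hx]

theorem posPow_of_neg (a : ℝ) {x : ℝ} (hx : x < 0) : posPow a x = 0 := by
  simp [posPow, hx.le]

theorem lintegral_posPow_mul {a b : ℝ} (ha : 0 < a) (hb : 0 < b) (r : ℝ) :
    ∫⁻ s, ENNReal.ofReal (posPow a s * posPow b (r - s)) =
      ENNReal.ofReal (ProbabilityTheory.beta a b * posPow (a + b) r) := by
  rcases le_or_gt r 0 with hr | hr
  · have : ∀ s, posPow a s * posPow b (r - s) = 0 := by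
      intro s
      rcases le_or_gt s 0 with hs | hs
      · simp [posPow, hs.not_gt]
      · simp [posPow, (show r - s ≤ 0 by linarith).not_gt]
    simp_rw [this]
    simp [posPow, hr.not_gt]
  · have hB := ProbabilityTheory.beta_pos ha hb
    have key : ∀ x, ENNReal.ofReal (posPow a (r * x) * posPow b (r - r * x)) =
        ENNReal.ofReal (ProbabilityTheory.beta a b * r ^ (a + b - 2)) *
          ProbabilityTheory.betaPDF a b x := by
      intro x
      rw [ProbabilityTheory.betaPDF_eq, ← ENNReal.ofReal_mul (by positivity)]
      congr 1
      by_cases h : 0 < x ∧ x < 1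
      · obtain ⟨h0, h1⟩ := h
        have h1' : 0 < 1 - x := by linarith
        rw [if_pos ⟨h0, h1⟩, show r - r * x = r * (1 - x) by ring, posPow, posPow,
          if_pos (by positivity), if_pos (by positivity), Real.mul_rpow hr.le h0.le,
          Real.mul_rpow hr.le h1'.le, show a + b - 2 = (a - 1) + (b - 1) by ring,
          Real.rpow_add hr]
        field_simp
      · rw [if_neg h, mul_zero]
        rcases not_and_or.1 h with h | h
        · simp [posPow, hr, h]
        · have : ¬ (0 < r - r * x) := by nlinarith
          simp [posPow, this]
    rw [← Real.smul_map_volume_mul_left hr.ne', lintegral_smul_measure,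
      lintegral_map (by fun_prop) (by fun_prop)]
    simp_rw [key]
    rw [lintegral_const_mul' _ _ ENNReal.ofReal_ne_top,
      ProbabilityTheory.lintegral_betaPDF_eq_one ha hb, mul_one, smul_eq_mul,
      ← ENNReal.ofReal_mul (abs_nonneg r), abs_of_pos hr]
    congr 1
    rw [posPow, if_pos hr, show a + b - 1 = (a + b - 2) + 1 by ring, Real.rpow_add_one hr.ne']
    ring

/-- Dirichlet's integral. -/
theorem lintegral_prod_posPow_mul (m : ℕ) (a : Fin m → ℝ) (ha : ∀ i, 0 < a i) (b : ℝ)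
    (hb : 0 < b) :
    ∫⁻ u : Fin m → ℝ, ENNReal.ofReal ((∏ i, posPow (a i) (u i)) * posPow b (1 - ∑ i, u i)) =
      ENNReal.ofReal ((∏ i, Gamma (a i)) * Gamma b / Gamma (∑ i, a i + b)) := by
  induction m generalizing b with
  | zero =>
    have := (Gamma_pos_of_pos hb).ne'
    simp [posPow, div_self this, volume_pi]
  | succ m ih =>
    have hab : 0 < a 0 + b := add_pos (ha 0) hb
    have hG := (Gamma_pos_of_pos hab).ne'
    have hmeas : Measurable fun p : ℝ × (Fin m → ℝ) =>
        ENNReal.ofReal ((posPow (a 0) p.1 * ∏ i : Fin m, posPow (a i.succ) (p.2 i)) *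
          posPow b (1 - (p.1 + ∑ i, p.2 i))) := by fun_prop
    calc _ = ∫⁻ p : ℝ × (Fin m → ℝ),
        ENNReal.ofReal ((posPow (a 0) p.1 * ∏ i : Fin m, posPow (a i.succ) (p.2 i)) *
          posPow b (1 - (p.1 + ∑ i, p.2 i))) := by
          rw [← (volume_preserving_piFinSuccAbove (fun _ : Fin (m + 1) => ℝ) 0).lintegral_comp hmeas]
          refine lintegral_congr fun u => ?_
          rw [Fin.prod_univ_succ, Fin.sum_univ_succ]
          simp [MeasurableEquiv.piFinSuccAbove, Fin.insertNthEquiv, Fin.tail]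
      _ = ∫⁻ v : Fin m → ℝ, ∫⁻ s,
          ENNReal.ofReal (∏ i : Fin m, posPow (a i.succ) (v i)) *
            ENNReal.ofReal (posPow (a 0) s * posPow b ((1 - ∑ i, v i) - s)) := by
          rw [Measure.volume_eq_prod, lintegral_prod_symm _ hmeas.aemeasurable]
          refine lintegral_congr fun v => lintegral_congr fun s => ?_
          rw [← ENNReal.ofReal_mul (prod_nonneg fun i _ => posPow_nonneg _ _)]
          congr 1
          rw [show 1 - (s + ∑ i, v i) = 1 - ∑ i, v i - s by ring]
          ring
      _ = ∫⁻ v : Fin m → ℝ, ENNReal.ofReal (ProbabilityTheory.beta (a 0) b) *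
          ENNReal.ofReal ((∏ i : Fin m, posPow (a i.succ) (v i)) *
            posPow (a 0 + b) (1 - ∑ i, v i)) := by
          refine lintegral_congr fun v => ?_
          rw [lintegral_const_mul' _ _ ENNReal.ofReal_ne_top, lintegral_posPow_mul (ha 0) hb,
            ← ENNReal.ofReal_mul (prod_nonneg fun i _ => posPow_nonneg _ _),
            ← ENNReal.ofReal_mul (ProbabilityTheory.beta_pos (ha 0) hb).le]
          congr 1
          ring
      _ = _ := by
          rw [lintegral_const_mul' _ _ ENNReal.ofReal_ne_top,
            ih (fun i => a i.succ) (fun i => ha _) (a 0 + b) hab,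
            ← ENNReal.ofReal_mul (ProbabilityTheory.beta_pos (ha 0) hb).le]
          congr 1
          rw [ProbabilityTheory.beta, Fin.prod_univ_succ, Fin.sum_univ_succ,
            show ∑ i : Fin m, a i.succ + (a 0 + b) = a 0 + ∑ i : Fin m, a i.succ + b by ring]
          field_simp

theorem integral_prod_posPow_mul (m : ℕ) (a : Fin m → ℝ) (ha : ∀ i, 0 < a i) (b : ℝ)
    (hb : 0 < b) :
    ∫ u : Fin m → ℝ, (∏ i, posPow (a i) (u i)) * posPow b (1 - ∑ i, u i) =
      (∏ i, Gamma (a i)) * Gamma b / Gamma (∑ i, a i + b) := by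
  rw [integral_eq_lintegral_of_nonneg_ae
      (.of_forall fun u => mul_nonneg (prod_nonneg fun i _ => posPow_nonneg _ _)
        (posPow_nonneg _ _))
      (Measurable.aestronglyMeasurable (by fun_prop)),
    lintegral_prod_posPow_mul m a ha b hb, ENNReal.toReal_ofReal]
  exact div_nonneg (mul_nonneg (prod_nonneg fun i _ => (Gamma_pos_of_pos (ha i)).le)
    (Gamma_pos_of_pos hb).le)
    (Gamma_pos_of_pos (add_pos_of_nonneg_of_pos (sum_nonneg fun i _ => (ha i).le) hb)).le

/-- The number of times the symbol `i` occurs in `x` at positions where `y` equals `j`. -/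
def symbolCount {m n t : ℕ} (x : Fin t → Fin (m + 1)) (y : Fin t → Fin (n + 1))
    (i : Fin (m + 1)) (j : Fin (n + 1)) : ℕ :=
  #{k | y k = j ∧ x k = i}

theorem pTheta_eq_prod_pow {m n t : ℕ} (θ : Fin (m + 1) → Fin (n + 1) → ℝ)
    (x : Fin t → Fin (m + 1)) (y : Fin t → Fin (n + 1)) :
    pTheta θ x y = ∏ j, ∏ i, θ i j ^ symbolCount x y i j := by
  rw [pTheta, ← prod_fiberwise univ y]
  refine prod_congr rfl fun j _ => ?_
  rw [← prod_fiberwise {k | y k = j} x]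
  refine prod_congr rfl fun i _ => ?_
  rw [symbolCount, filter_filter, ← prod_const]
  refine prod_congr rfl fun k hk => ?_
  rw [(mem_filter.1 hk).2.1, (mem_filter.1 hk).2.2]

theorem sum_symbolCount_le {m n t : ℕ} (x : Fin t → Fin (m + 1)) (y : Fin t → Fin (n + 1))
    (j : Fin (n + 1)) : ∑ i, symbolCount x y i j ≤ t := by
  have h : ∑ i, symbolCount x y i j = #{k | y k = j} := by
    rw [card_eq_sum_card_fiberwise (f := x) (t := univ) (fun _ _ => mem_coe.2 (mem_univ _))]
    simp [symbolCount, filter_filter]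
  rw [h]
  exact (card_le_univ _).trans_eq (Fintype.card_fin t)

theorem thetaOf_castSucc (m n : ℕ) (U : Fin (n + 1) → Fin m → ℝ) (i : Fin m)
    (j : Fin (n + 1)) : thetaOf m n U i.castSucc j = U j i := by
  simp [thetaOf]

theorem thetaOf_last (m n : ℕ) (U : Fin (n + 1) → Fin m → ℝ) (j : Fin (n + 1)) :
    thetaOf m n U (Fin.last m) j = 1 - ∑ i, U j i := by
  simp [thetaOf]

theorem mem_paramSet_iff {m n : ℕ} {U : Fin (n + 1) → Fin m → ℝ} :
    U ∈ paramSet m n ↔ ∀ j i, 0 ≤ thetaOf m n U i j := by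
  simp [paramSet, Fin.forall_fin_succ', thetaOf_castSucc, thetaOf_last]

theorem measurableSet_paramSet (m n : ℕ) : MeasurableSet (paramSet m n) := by
  simp only [paramSet, Set.ofPred_forall, Set.ofPred_and]
  refine .iInter fun j => .inter (.iInter fun i => ?_) ?_
  · exact measurableSet_le measurable_const (by fun_prop)
  · exact measurableSet_le (by fun_prop) measurable_const

theorem setIntegral_paramSet (m n : ℕ) (c : Fin (m + 1) → Fin (n + 1) → ℕ) :
    ∫ U in paramSet m n, (∏ i, ∏ j, (thetaOf m n U i j) ^ (-(1 : ℝ) / 2)) *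
        ∏ j, ∏ i, thetaOf m n U i j ^ c i j =
      ∏ j, ((∏ i, Gamma (c i j + 1 / 2)) / Gamma ((∑ i, c i j : ℕ) + ((m : ℝ) + 1) / 2)) := by
  have hpoint : ∀ U : Fin (n + 1) → Fin m → ℝ,
      (paramSet m n).indicator (fun U => (∏ i, ∏ j, (thetaOf m n U i j) ^ (-(1 : ℝ) / 2)) *
        ∏ j, ∏ i, thetaOf m n U i j ^ c i j) U =
      ∏ j, ((∏ i : Fin m, posPow (c i.castSucc j + 1 / 2) (U j i)) *
        posPow (c (Fin.last m) j + 1 / 2) (1 - ∑ i, U j i)) := by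
    intro U
    have hR : ∏ j, ((∏ i : Fin m, posPow (c i.castSucc j + 1 / 2) (U j i)) *
        posPow (c (Fin.last m) j + 1 / 2) (1 - ∑ i, U j i)) =
        ∏ j, ∏ i, posPow (c i j + 1 / 2) (thetaOf m n U i j) := by
      refine prod_congr rfl fun j _ => ?_
      rw [Fin.prod_univ_castSucc, thetaOf_last]
      simp_rw [thetaOf_castSucc]
    rw [hR]
    by_cases hU : U ∈ paramSet m n
    · rw [Set.indicator_of_mem hU, prod_comm, ← prod_mul_distrib]
      refine prod_congr rfl fun j _ => ?_
      rw [← prod_mul_distrib]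
      refine prod_congr rfl fun i _ => ?_
      have hne : (c i j : ℝ) + 1 / 2 ≠ 1 := by
        intro h
        have h2 : ((2 * c i j + 1 : ℕ) : ℝ) = (2 : ℕ) := by push_cast; linarith
        have := Nat.cast_injective h2
        omega
      rw [posPow_of_nonneg hne (mem_paramSet_iff.1 hU j i)]
      rcases (mem_paramSet_iff.1 hU j i).eq_or_lt with h | h
      · rw [← h, Real.zero_rpow (by norm_num), Real.zero_rpow (sub_ne_zero.2 hne), zero_mul]
      · rw [← Real.rpow_natCast, ← Real.rpow_add h]
        congr 1
        ring
    · rw [Set.indicator_of_notMem hU]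
      simp only [mem_paramSet_iff, not_forall, not_le] at hU
      obtain ⟨j, i, h⟩ := hU
      exact (prod_eq_zero (mem_univ j) (prod_eq_zero (mem_univ i) (posPow_of_neg _ h))).symm
  rw [← integral_indicator (measurableSet_paramSet m n)]
  simp_rw [hpoint]
  rw [integral_fintype_prod_volume_eq_prod fun (j : Fin (n + 1)) (u : Fin m → ℝ) =>
    (∏ i : Fin m, posPow (c i.castSucc j + 1 / 2) (u i)) *
      posPow (c (Fin.last m) j + 1 / 2) (1 - ∑ i, u i)]
  refine prod_congr rfl fun j _ => ?_
  rw [integral_prod_posPow_mul m (fun i => c i.castSucc j + 1 / 2) (fun i => by positivity) _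
    (by positivity), ← Fin.prod_univ_castSucc fun i => Gamma (c i j + 1 / 2),
    ← Fin.sum_univ_castSucc fun i => (c i j + 1 / 2 : ℝ), sum_add_distrib]
  congr 2
  simp
  ring

theorem jeffreysB_eq (m n : ℕ) :
    jeffreysB m n = (Gamma (1 / 2) ^ (m + 1) / Gamma (((m : ℝ) + 1) / 2)) ^ (n + 1) := by
  simpa [jeffreysB, div_pow] using setIntegral_paramSet m n 0

theorem pUniv_eq (m n : ℕ) {t : ℕ} (x : Fin t → Fin (m + 1)) (y : Fin t → Fin (n + 1)) :
    pUniv m n x y =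
      ((Gamma (1 / 2) ^ (m + 1) / Gamma (((m : ℝ) + 1) / 2)) ^ (n + 1))⁻¹ *
      ∏ j, ((∏ i, Gamma (symbolCount x y i j + 1 / 2)) /
        Gamma ((∑ i, symbolCount x y i j : ℕ) + ((m : ℝ) + 1) / 2)) := by
  simp_rw [pUniv, jeffreysB_eq, pTheta_eq_prod_pow, setIntegral_paramSet]

theorem pUniv_pos (m n : ℕ) {t : ℕ} (x : Fin t → Fin (m + 1)) (y : Fin t → Fin (n + 1)) :
    0 < pUniv m n x y := by
  rw [pUniv_eq]
  have h : ∀ s : ℝ, 0 ≤ s → 0 < Gamma (s + ((m : ℝ) + 1) / 2) := fun s hs =>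
    Gamma_pos_of_pos (by positivity)
  have h0 := h 0 le_rfl
  rw [zero_add] at h0
  have h1 : 0 < Gamma (1 / 2 : ℝ) := Gamma_pos_of_pos (by norm_num)
  exact mul_pos (by positivity) (prod_pos fun j _ => div_pos
    (prod_pos fun i _ => Gamma_pos_of_pos (by positivity)) (h _ (Nat.cast_nonneg _)))

theorem pTheta_le_mul_pUniv (m n t : ℕ) (ht : 1 ≤ t)
    (x : Fin t → Fin (m + 1)) (y : Fin t → Fin (n + 1))
    (θ : Fin (m + 1) → Fin (n + 1) → ℝ) (hθ : θ ∈ colStoch m n) :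
    pTheta θ x y ≤ ((√(t / (2 * π)) ^ m * exp (((m : ℝ) + 1) ^ 2 / 4 + ((m : ℝ) + 1) / 2)) *
      (Gamma (1 / 2) ^ (m + 1) / Gamma (((m : ℝ) + 1) / 2))) ^ (n + 1) * pUniv m n x y := by
  have hW : 0 < Gamma (1 / 2) ^ (m + 1) / Gamma (((m : ℝ) + 1) / 2) :=
    div_pos (pow_pos (Gamma_pos_of_pos (by norm_num)) _) (Gamma_pos_of_pos (by positivity))
  rw [pUniv_eq, pTheta_eq_prod_pow, mul_pow, mul_assoc, mul_inv_cancel_left₀ (pow_pos hW _).ne']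
  calc _ ≤ ∏ j : Fin (n + 1),
      ((√(t / (2 * π)) ^ m * exp (((m : ℝ) + 1) ^ 2 / 4 + ((m : ℝ) + 1) / 2)) *
        ((∏ i, Gamma (symbolCount x y i j + 1 / 2)) /
          Gamma ((∑ i, symbolCount x y i j : ℕ) + ((m : ℝ) + 1) / 2))) := by
        refine prod_le_prod (fun j _ => prod_nonneg fun i _ => pow_nonneg (hθ.1 i j) _)
          fun j _ => ?_
        rw [← mul_div_assoc, le_div_iff₀ (Gamma_pos_of_pos (by positivity))]
        exact prod_pow_mul_Gamma_le m (fun i => symbolCount x y i j) (fun i => θ i j)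
          (fun i => hθ.1 i j) (hθ.2 j) t (by exact_mod_cast ht)
          (by exact_mod_cast sum_symbolCount_le x y j)
    _ = _ := by simp [prod_mul_distrib]

theorem pTheta_pos_of_isMax {m n t : ℕ} {x : Fin t → Fin (m + 1)} {y : Fin t → Fin (n + 1)}
    {θ : Fin (m + 1) → Fin (n + 1) → ℝ}
    (hθ : ∀ θ' ∈ colStoch m n, pTheta θ' x y ≤ pTheta θ x y) : 0 < pTheta θ x y := by
  refine lt_of_lt_of_le ?_ (hθ (fun _ _ => 1 / ((m : ℝ) + 1)) ⟨fun _ _ => by positivity, ?_⟩)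
  · exact prod_pos fun _ _ => by positivity
  · intro j
    simp
    field_simp

/-- Lemma (pointwise redundancy of the Jeffreys-mixture universal probability assignment):
for every `t ≥ 1` and all sequences `x^t, y^t`, if `θ̂` maximizes `θ ↦ p_θ(x^t|y^t)` over `Λ`,
then `log₂(p_θ̂(x^t|y^t)/p_U(x^t|y^t))
  ≤ ((|𝒳|−1)|𝒴|/2)·log₂(t/(2π)) + |𝒴|·log₂(Γ(1/2)^{|𝒳|}/Γ(|𝒳|/2))
    + (|𝒳|²|𝒴|/4 + |𝒳||𝒴|/2)·log₂ e`,
where `|𝒳| = m+1` and `|𝒴| = n+1`. -/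
theorem jeffreys_mixture_redundancy (m n : ℕ) (t : ℕ) (ht : 1 ≤ t)
    (x : Fin t → Fin (m + 1)) (y : Fin t → Fin (n + 1))
    (θhat : Fin (m + 1) → Fin (n + 1) → ℝ) (hθhat_mem : θhat ∈ colStoch m n)
    (hθhat_max : ∀ θ ∈ colStoch m n, pTheta θ x y ≤ pTheta θhat x y) :
    Real.logb 2 (pTheta θhat x y / pUniv m n x y) ≤
      ((m : ℝ) * ((n : ℝ) + 1) / 2) * Real.logb 2 (t / (2 * Real.pi)) +
      ((n : ℝ) + 1) *
        Real.logb 2 (Real.Gamma (1 / 2) ^ (m + 1) / Real.Gamma (((m : ℝ) + 1) / 2)) +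
      (((m : ℝ) + 1) ^ 2 * ((n : ℝ) + 1) / 4 + ((m : ℝ) + 1) * ((n : ℝ) + 1) / 2) *
        Real.logb 2 (Real.exp 1) := by
  have hp := pTheta_pos_of_isMax hθhat_max
  have hU := pUniv_pos m n x y
  have hW : 0 < Gamma (1 / 2) ^ (m + 1) / Gamma (((m : ℝ) + 1) / 2) :=
    div_pos (pow_pos (Gamma_pos_of_pos (by norm_num)) _) (Gamma_pos_of_pos (by positivity))
  have ht' : (0 : ℝ) < t := by exact_mod_cast ht
  have hs : 0 < √(t / (2 * π)) := by positivity
  have hle := (div_le_iff₀ hU).2 (pTheta_le_mul_pUniv m n t ht x y θhat hθhat_mem)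
  refine (Real.logb_le_logb_of_le one_lt_two (div_pos hp hU) hle).trans_eq ?_
  have hexp : ∀ z : ℝ, Real.logb 2 (exp z) = z * Real.logb 2 (exp 1) := by
    intro z
    simp [Real.logb, div_eq_mul_inv]
  have hsqrt : Real.logb 2 (√(t / (2 * π))) = 1 / 2 * Real.logb 2 (t / (2 * π)) := by
    rw [Real.sqrt_eq_rpow, Real.logb_rpow_eq_mul_logb_of_pos (by positivity)]
  rw [Real.logb_pow, Real.logb_mul (by positivity) hW.ne', Real.logb_mul (by positivity)
    (exp_pos _).ne', Real.logb_pow, hexp, hsqrt]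
  push_cast
  ring
end
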